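/- Let 1 ≤ p, q ≤ ∞, let p′, q′ be the conjugate exponents (1/p + 1/p′ = 1, 1/q + 1/q′ = 1), and let ε > 0. Then there is a constant C > 0 such that for all Schwartz functions f, g on ℝ: ‖BH(f,g)‖_{M^{1+ε,∞}} ≤ C · ‖f‖_{M^{p,q}} · ‖g‖_{M^{p′,q′}}. -/

import Mathlib

open MeasureTheory Complex
open scoped ENNReal NNReal

noncomputable section

/-- `e2pi a = e^{2πi a}`. -/
def e2pi (a : ℝ) : ℂ := Complex.exp (2 * Real.pi * Complex.I * (a : ℂ))

/-- Short-time Fourier transform on `ℝ`: `V_φ f (t, ν)`. -/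
def STFT1 (φ f : ℝ → ℂ) (t ν : ℝ) : ℂ := ∫ y : ℝ, f y * e2pi (-(y * ν)) * φ (y - t)

/-- The Gaussian window `e^{-x²}` on `ℝ`. -/
def gauss1 : ℝ → ℂ := fun x => (Real.exp (-x ^ 2) : ℝ)

/-- `L^p`-type norm (`ℝ≥0∞`-valued) with essential supremum in case `p = ∞`. -/
def eNorm {α : Type*} [MeasurableSpace α] (μ : Measure α) (p : ℝ≥0∞) (F : α → ℝ≥0∞) : ℝ≥0∞ :=
  if p = ∞ then essSup F μ else (∫⁻ a, F a ^ p.toReal ∂μ) ^ (1 / p.toReal)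

/-- Modulation space norm `‖f‖_{M^{p,q}}` on `ℝ` with the Gaussian window. -/
def modNorm1 (p q : ℝ≥0∞) (f : ℝ → ℂ) : ℝ≥0∞ :=
  eNorm volume q fun ν => eNorm volume p fun t => (‖STFT1 gauss1 f t ν‖₊ : ℝ≥0∞)

/-- Fourier transform on `ℝ`. -/
def FT1 (f : ℝ → ℂ) (ξ : ℝ) : ℂ := ∫ y : ℝ, f y * e2pi (-(y * ξ))

/-- Symbol short-time Fourier transform of a symbol on `ℝ³`. -/
def symbSTFT3 (Ψ σ : ℝ × ℝ × ℝ → ℂ) (x t₁ t₂ ξ₁ ξ₂ ν : ℝ) : ℂ :=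
  ∫ X : ℝ × ℝ × ℝ, σ X * Ψ (X.1 - x, X.2.1 - ξ₁, X.2.2 - ξ₂) *
    e2pi (-(X.1 * ν - t₁ * X.2.1 - t₂ * X.2.2))

/-- Symbol short-time Fourier transform of a symbol on `ℝ⁴`. -/
def symbSTFT4 (Ψ σ : ℝ × ℝ × ℝ × ℝ → ℂ) (x t₁ t₂ t₃ ξ₁ ξ₂ ξ₃ ν : ℝ) : ℂ :=
  ∫ X : ℝ × ℝ × ℝ × ℝ, σ X * Ψ (X.1 - x, X.2.1 - ξ₁, X.2.2.1 - ξ₂, X.2.2.2 - ξ₃) *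
    e2pi (-(X.1 * ν - t₁ * X.2.1 - t₂ * X.2.2.1 - t₃ * X.2.2.2))

/-- The bilinear Hilbert transform as an (absolutely convergent) bilinear Fourier
multiplier for Schwartz functions. -/
def BH (f g : ℝ → ℂ) (x : ℝ) : ℂ :=
  ∫ ξ : ℝ × ℝ, (-(Real.pi : ℂ) * Complex.I * (Real.sign (ξ.1 - ξ.2) : ℝ)) *
    FT1 f ξ.1 * FT1 g ξ.2 * e2pi (x * (ξ.1 + ξ.2))

/-- The trilinear Hilbert transform as an (absolutely convergent) trilinear Fourier
multiplier for Schwartz functions. -/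
def TH (f g h : ℝ → ℂ) (x : ℝ) : ℂ :=
  ∫ ξ : ℝ × ℝ × ℝ, ((Real.pi : ℂ) * Complex.I * (Real.sign (ξ.1 - ξ.2.1 - 2 * ξ.2.2) : ℝ)) *
    FT1 f ξ.1 * FT1 g ξ.2.1 * FT1 h ξ.2.2 * e2pi (x * (ξ.1 + ξ.2.1 + ξ.2.2))
theorem lintegral_mul_le_eNorm_mul_eNorm {α : Type*} [MeasurableSpace α] {μ : Measure α}
    {p p' : ℝ≥0∞} (hp : 1 ≤ p) (hp' : 1 ≤ p') (hpc : 1 / p + 1 / p' = 1) {F G : α → ℝ≥0∞}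
    (hF : AEMeasurable F μ) (hG : AEMeasurable G μ) :
    ∫⁻ a, F a * G a ∂μ ≤ eNorm μ p F * eNorm μ p' G := by
  by_cases h : p = ∞
  · have h1 : p' = 1 := by simpa [h] using hpc
    subst h1
    simp only [eNorm, h, if_true, ENNReal.one_ne_top, if_false, ENNReal.toReal_one,
      ENNReal.rpow_one, div_one]
    rw [← lintegral_const_mul'' _ hG]
    refine lintegral_mono_ae ?_
    filter_upwards [ENNReal.ae_le_essSup F] with a ha
    gcongr
  by_cases h' : p' = ∞
  · have h1 : p = 1 := by simpa [h'] using hpc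
    subst h1
    simp only [eNorm, h', if_true, ENNReal.one_ne_top, if_false, ENNReal.toReal_one,
      ENNReal.rpow_one, div_one]
    rw [← lintegral_mul_const'' _ hF]
    refine lintegral_mono_ae ?_
    filter_upwards [ENNReal.ae_le_essSup G] with a ha
    gcongr
  · have hc : p.toReal.HolderConjugate p'.toReal := by
      have : ENNReal.HolderConjugate p p' := by
        rw [ENNReal.holderConjugate_iff]; simpa using hpc
      exact ENNReal.HolderConjugate.toReal_of_ne_top h h'
    simp only [eNorm, h, h', if_false]
    exact ENNReal.lintegral_mul_le_Lp_mul_Lq μ hc hF hG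

theorem eNorm_comp {α : Type*} [MeasurableSpace α] {μ : Measure α} {e : α → α}
    (he : MeasurePreserving e μ μ) (he' : MeasurableEmbedding e) (p : ℝ≥0∞) (F : α → ℝ≥0∞) :
    eNorm μ p (fun a => F (e a)) = eNorm μ p F := by
  unfold eNorm
  split_ifs
  · conv_rhs => rw [← he.map_eq]
    exact (he'.essSup_map_measure (f := e) (g := F)).symm
  · rw [he.lintegral_comp_emb he' (fun a => F a ^ p.toReal)]

theorem essSup_eq_iSup_of_continuous {f : ℝ → ℝ≥0∞} (hf : Continuous f) :
    essSup f volume = ⨆ t, f t := by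
  refine le_antisymm (essSup_le_of_ae_le _ (Filter.Eventually.of_forall fun t => le_iSup f t)) ?_
  refine iSup_le fun t => ?_
  by_contra! h
  have ho : IsOpen {t | essSup f volume < f t} := isOpen_lt continuous_const hf
  have h0 : volume {t | essSup f volume < f t} = 0 := meas_essSup_lt
  rw [ho.measure_eq_zero_iff volume] at h0
  exact (Set.eq_empty_iff_forall_notMem.1 h0 t) h

theorem measurable_eNorm {F : ℝ → ℝ → ℝ≥0∞} (hF : Continuous fun z : ℝ × ℝ => F z.1 z.2)
    (p : ℝ≥0∞) : Measurable fun ν => eNorm volume p fun t => F t ν := by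
  unfold eNorm
  split_ifs
  · have : (fun ν => essSup (fun t => F t ν) volume) = fun ν => ⨆ t, F t ν := by
      funext ν
      exact essSup_eq_iSup_of_continuous (hF.comp (by fun_prop : Continuous fun t => (t, ν)))
    rw [this]
    refine (lowerSemicontinuous_iSup fun t => ?_).measurable
    exact (hF.comp (by fun_prop : Continuous fun ν => (t, ν))).lowerSemicontinuous
  · refine Measurable.pow_const ?_ _
    exact Measurable.lintegral_prod_left' (f := fun z : ℝ × ℝ => F z.1 z.2 ^ p.toReal)
      (hF.measurable.pow_const _)

/-- Frequency-integrated product of two time-frequency profiles at times `x ∓ s`. -/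
def crossMass (F G : ℝ → ℝ → ℝ≥0∞) (ν x s : ℝ) : ℝ≥0∞ :=
  ∫⁻ ξ, F (x - s) ξ * G (x + s) (ν - ξ)

theorem measurable_crossMass {F G : ℝ → ℝ → ℝ≥0∞}
    (hF : Continuous fun z : ℝ × ℝ => F z.1 z.2) (hG : Continuous fun z : ℝ × ℝ => G z.1 z.2)
    (ν : ℝ) : Measurable fun z : ℝ × ℝ => crossMass F G ν z.1 z.2 := by
  unfold crossMass
  have h1 : Measurable fun w : (ℝ × ℝ) × ℝ => F (w.1.1 - w.1.2) w.2 :=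
    (hF.comp (by fun_prop : Continuous fun w : (ℝ × ℝ) × ℝ => (w.1.1 - w.1.2, w.2))).measurable
  have h2 : Measurable fun w : (ℝ × ℝ) × ℝ => G (w.1.1 + w.1.2) (ν - w.2) :=
    (hG.comp (by fun_prop : Continuous fun w : (ℝ × ℝ) × ℝ => (w.1.1 + w.1.2, ν - w.2))).measurable
  exact (h1.mul h2).lintegral_prod_right'

/-- Hölder's inequality in time and then in frequency, along any pair of measure preserving
reparametrisations of time. -/
theorem lintegral_lintegral_mul_le {F G : ℝ → ℝ → ℝ≥0∞}
    (hF : Continuous fun z : ℝ × ℝ => F z.1 z.2) (hG : Continuous fun z : ℝ × ℝ => G z.1 z.2)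
    {p q p' q' : ℝ≥0∞} (hp : 1 ≤ p) (hq : 1 ≤ q) (hp' : 1 ≤ p') (hq' : 1 ≤ q')
    (hpc : 1 / p + 1 / p' = 1) (hqc : 1 / q + 1 / q' = 1) (ν : ℝ) (e e' : ℝ ≃ₜ ℝ)
    (he : MeasurePreserving e) (he' : MeasurePreserving e') :
    ∫⁻ t, ∫⁻ ξ, F (e t) ξ * G (e' t) (ν - ξ) ≤
      (eNorm volume q fun ν => eNorm volume p fun t => F t ν) *
        (eNorm volume q' fun ν => eNorm volume p' fun t => G t ν) := by
  have mF : Measurable fun w : ℝ × ℝ => F (e w.1) w.2 :=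
    (hF.comp (by fun_prop : Continuous fun w : ℝ × ℝ => (e w.1, w.2))).measurable
  have mG : Measurable fun w : ℝ × ℝ => G (e' w.1) (ν - w.2) :=
    (hG.comp (by fun_prop : Continuous fun w : ℝ × ℝ => (e' w.1, ν - w.2))).measurable
  rw [lintegral_lintegral_swap (mF.mul mG).aemeasurable]
  calc ∫⁻ ξ, ∫⁻ t, F (e t) ξ * G (e' t) (ν - ξ)
      ≤ ∫⁻ ξ, (eNorm volume p fun t => F t ξ) * (eNorm volume p' fun t => G t (ν - ξ)) := by
        refine lintegral_mono fun ξ => ?_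
        refine (lintegral_mul_le_eNorm_mul_eNorm hp hp' hpc
          (mF.comp (by fun_prop : Measurable fun t : ℝ => (t, ξ))).aemeasurable
          (mG.comp (by fun_prop : Measurable fun t : ℝ => (t, ξ))).aemeasurable).trans_eq ?_
        exact congrArg₂ _ (eNorm_comp he e.measurableEmbedding p fun t => F t ξ)
          (eNorm_comp he' e'.measurableEmbedding p' fun t => G t (ν - ξ))
    _ ≤ _ := by
        refine (lintegral_mul_le_eNorm_mul_eNorm hq hq' hqc (measurable_eNorm hF p).aemeasurable
          ((measurable_eNorm hG p').comp (by fun_prop : Measurable fun ξ : ℝ => ν - ξ)).aemeasurable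
          ).trans_eq ?_
        congr 1
        exact eNorm_comp (Measure.measurePreserving_sub_left volume ν)
          (Homeomorph.subLeft ν).measurableEmbedding q' fun ξ => eNorm volume p' fun t => G t ξ

theorem rpow_lintegral_mul_le {α : Type*} [MeasurableSpace α] {μ : Measure α} {r : ℝ} (hr : 1 < r)
    {a k : α → ℝ≥0∞} (ha : AEMeasurable a μ) (hk : AEMeasurable k μ) :
    (∫⁻ t, a t * k t ∂μ) ^ r ≤ (∫⁻ t, a t ∂μ) ^ (r - 1) * ∫⁻ t, a t * k t ^ r ∂μ := by
  have hc := (Real.HolderConjugate.conjExponent hr).symm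
  set r' := r.conjExponent
  have hr0 : 0 < r := by linarith
  have hs : 1 / r' + 1 / r = 1 := by simpa using hc.inv_add_inv_eq_one
  have key := ENNReal.lintegral_mul_le_Lp_mul_Lq μ hc (ha.pow_const (1 / r'))
    ((ha.pow_const (1 / r)).mul hk)
  have e1 : ∀ t, a t * k t = ((fun t => a t ^ (1 / r')) * (fun t => a t ^ (1 / r)) * k) t := by
    intro t
    simp only [Pi.mul_apply]
    rw [← ENNReal.rpow_add_of_nonneg _ _ (by have := hc.pos; positivity) (by positivity), hs,
      ENNReal.rpow_one]
  rw [lintegral_congr e1, mul_assoc]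
  refine (ENNReal.rpow_le_rpow key hr0.le).trans_eq ?_
  rw [ENNReal.mul_rpow_of_nonneg _ _ hr0.le, ← ENNReal.rpow_mul, ← ENNReal.rpow_mul]
  have e2 : 1 / r' * r = r - 1 := by
    have : 1 / r' = 1 - 1 / r := by linarith
    rw [this]; field_simp
  have e3 : 1 / r * r = 1 := by field_simp
  rw [e2, e3, ENNReal.rpow_one]
  congr 2
  · refine lintegral_congr fun t => ?_
    rw [← ENNReal.rpow_mul, one_div_mul_cancel hc.pos.ne', ENNReal.rpow_one]
  · funext t
    simp only [Pi.mul_apply]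
    rw [ENNReal.mul_rpow_of_nonneg _ _ hr0.le, ← ENNReal.rpow_mul, e3, ENNReal.rpow_one]

theorem lintegral_rpow_lintegral_mul_le {Ω : Type*} [MeasurableSpace Ω] {μ : Measure Ω} [SFinite μ]
    {r : ℝ} (hr : 1 < r) {A : ℝ → Ω → ℝ≥0∞} (hA : Measurable fun z : ℝ × Ω => A z.1 z.2)
    {k : Ω → ℝ≥0∞} (hk : Measurable k) {M N : ℝ≥0∞} (h1 : ∀ x, ∫⁻ s, A x s ∂μ ≤ M)
    (h2 : ∀ s, ∫⁻ x, A x s ≤ N) :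
    ∫⁻ x, (∫⁻ s, A x s * k s ∂μ) ^ r ≤ M ^ (r - 1) * (N * ∫⁻ s, k s ^ r ∂μ) := by
  calc ∫⁻ x, (∫⁻ s, A x s * k s ∂μ) ^ r
      ≤ ∫⁻ x, M ^ (r - 1) * ∫⁻ s, A x s * k s ^ r ∂μ := by
        refine lintegral_mono fun x => ?_
        refine (rpow_lintegral_mul_le (a := A x) hr (hA.comp (by fun_prop :
          Measurable fun s : Ω => (x, s))).aemeasurable hk.aemeasurable).trans ?_
        gcongr
        exact h1 x
    _ = M ^ (r - 1) * ∫⁻ s, (∫⁻ x, A x s) * k s ^ r ∂μ := by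
        have hm : Measurable fun z : ℝ × Ω => A z.1 z.2 * k z.2 ^ r :=
          hA.mul ((hk.comp measurable_snd).pow_const r)
        rw [lintegral_const_mul _ hm.lintegral_prod_right',
          lintegral_lintegral_swap hm.aemeasurable]
        congr 1
        refine lintegral_congr fun s => ?_
        exact lintegral_mul_const (f := fun x => A x s) (k s ^ r)
          (hA.comp (by fun_prop : Measurable fun x : ℝ => (x, s)))
    _ ≤ _ := by
        rw [← lintegral_const_mul _ (hk.pow_const r)]
        gcongr with s
        exact h2 s

theorem lintegral_crossMass_le {F G : ℝ → ℝ → ℝ≥0∞}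
    (hF : Continuous fun z : ℝ × ℝ => F z.1 z.2) (hG : Continuous fun z : ℝ × ℝ => G z.1 z.2)
    {p q p' q' : ℝ≥0∞} (hp : 1 ≤ p) (hq : 1 ≤ q) (hp' : 1 ≤ p') (hq' : 1 ≤ q')
    (hpc : 1 / p + 1 / p' = 1) (hqc : 1 / q + 1 / q' = 1) (ν s : ℝ) :
    ∫⁻ x, crossMass F G ν x s ≤ (eNorm volume q fun ν => eNorm volume p fun t => F t ν) *
        (eNorm volume q' fun ν => eNorm volume p' fun t => G t ν) :=
  lintegral_lintegral_mul_le hF hG hp hq hp' hq' hpc hqc ν (Homeomorph.subRight s)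
    (Homeomorph.addRight s) (measurePreserving_sub_right volume s)
    (measurePreserving_add_right volume s)

theorem lintegral_crossMass_shift_le {F G : ℝ → ℝ → ℝ≥0∞}
    (hF : Continuous fun z : ℝ × ℝ => F z.1 z.2) (hG : Continuous fun z : ℝ × ℝ => G z.1 z.2)
    {p q p' q' : ℝ≥0∞} (hp : 1 ≤ p) (hq : 1 ≤ q) (hp' : 1 ≤ p') (hq' : 1 ≤ q')
    (hpc : 1 / p + 1 / p' = 1) (hqc : 1 / q + 1 / q' = 1) (ν x : ℝ) :
    ∫⁻ s, crossMass F G ν x s ≤ (eNorm volume q fun ν => eNorm volume p fun t => F t ν) *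
        (eNorm volume q' fun ν => eNorm volume p' fun t => G t ν) :=
  lintegral_lintegral_mul_le hF hG hp hq hp' hq' hpc hqc ν (Homeomorph.subLeft x)
    (Homeomorph.addLeft x) (Measure.measurePreserving_sub_left volume x)
    (measurePreserving_add_left volume x)

/-- `L^r` bound for a smoothed superposition of cross masses. -/
theorem lintegral_rpow_smoothed_crossMass_le {F G : ℝ → ℝ → ℝ≥0∞}
    (hF : Continuous fun z : ℝ × ℝ => F z.1 z.2) (hG : Continuous fun z : ℝ × ℝ => G z.1 z.2)
    {p q p' q' : ℝ≥0∞} (hp : 1 ≤ p) (hq : 1 ≤ q) (hp' : 1 ≤ p') (hq' : 1 ≤ q')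
    (hpc : 1 / p + 1 / p' = 1) (hqc : 1 / q + 1 / q' = 1) (ν : ℝ) {r : ℝ} (hr : 1 < r)
    {h k : ℝ → ℝ≥0∞} (hh : Measurable h) (hk : Measurable k) :
    ∫⁻ x, (∫⁻ z, h z * ((∫⁻ s, crossMass F G ν (x + z) s * k s) + crossMass F G ν (x + z) 0)) ^ r ≤
      2 ^ (r - 1) * ((∫⁻ z, h z) ^ r * (∫⁻ s, k s ^ r) + ∫⁻ z, h z ^ r) *
      ((eNorm volume q fun ν => eNorm volume p fun t => F t ν) *
        (eNorm volume q' fun ν => eNorm volume p' fun t => G t ν)) ^ r := by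
  have hr0 : 0 < r := by linarith
  have hr1 : 0 ≤ r - 1 := by linarith
  have b1 := lintegral_crossMass_le hF hG hp hq hp' hq' hpc hqc ν
  have b2 := lintegral_crossMass_shift_le hF hG hp hq hp' hq' hpc hqc ν
  set N := (eNorm volume q fun ν => eNorm volume p fun t => F t ν) *
        (eNorm volume q' fun ν => eNorm volume p' fun t => G t ν)
  have mc := measurable_crossMass hF hG ν
  set D : ℝ → ℝ≥0∞ := fun x => ∫⁻ s, crossMass F G ν x s * k s with hD
  have mD : Measurable D := (mc.mul (hk.comp measurable_snd)).lintegral_prod_right'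
  have mc0 : Measurable fun x => crossMass F G ν x 0 :=
    mc.comp (by fun_prop : Measurable fun x : ℝ => (x, (0 : ℝ)))
  have hN : ∀ y : ℝ≥0∞, N ^ (r - 1) * (N * y) = N ^ r * y := fun y => by
    have : N ^ r = N ^ (r - 1) * N := by
      conv_rhs => rw [← ENNReal.rpow_one N, ← ENNReal.rpow_mul, one_mul]
      rw [← ENNReal.rpow_add_of_nonneg _ _ hr1 zero_le_one, sub_add_cancel]
    rw [this]
    exact (mul_assoc _ _ _).symm
  have hDr : ∫⁻ x, D x ^ r ≤ N ^ r * ∫⁻ s, k s ^ r :=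
    (lintegral_rpow_lintegral_mul_le hr mc hk b2 b1).trans_eq (hN _)
  have lintegral_shift (f : ℝ → ℝ≥0∞) (z : ℝ) : ∫⁻ x, f (x + z) = ∫⁻ x, f x :=
    lintegral_add_right_eq_self f z
  have mDs : Measurable fun w : ℝ × ℝ => D (w.1 + w.2) ^ r :=
    (mD.comp (by fun_prop : Measurable fun w : ℝ × ℝ => w.1 + w.2)).pow_const r
  have hP : ∫⁻ x, (∫⁻ z, h z * D (x + z)) ^ r ≤
      (∫⁻ z, h z) ^ r * (∫⁻ s, k s ^ r) * N ^ r := by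
    calc ∫⁻ x, (∫⁻ z, h z * D (x + z)) ^ r
        ≤ ∫⁻ x, (∫⁻ z, h z) ^ (r - 1) * ∫⁻ z, h z * D (x + z) ^ r :=
          lintegral_mono fun x => rpow_lintegral_mul_le hr hh.aemeasurable
            (mD.comp (measurable_const_add x)).aemeasurable
      _ = (∫⁻ z, h z) ^ (r - 1) * ∫⁻ z, h z * ∫⁻ x, D x ^ r := by
          have hm : Measurable fun w : ℝ × ℝ => h w.2 * D (w.1 + w.2) ^ r :=
            (hh.comp measurable_snd).mul mDs
          rw [lintegral_const_mul _ hm.lintegral_prod_right',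
            lintegral_lintegral_swap hm.aemeasurable]
          congr 1
          refine lintegral_congr fun z => ?_
          rw [← lintegral_shift (fun x => D x ^ r) z]
          exact lintegral_const_mul (f := fun x => D (x + z) ^ r) (h z)
            (mDs.comp (by fun_prop : Measurable fun x : ℝ => (x, z)))
      _ = (∫⁻ z, h z) ^ r * ∫⁻ x, D x ^ r := by
          rw [lintegral_mul_const _ hh, ← mul_assoc]
          congr 1
          conv_lhs => rw [← ENNReal.rpow_one (∫⁻ z, h z), ← ENNReal.rpow_mul, one_mul]
          rw [← ENNReal.rpow_add_of_nonneg _ _ hr1 zero_le_one, sub_add_cancel]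
      _ ≤ (∫⁻ z, h z) ^ r * (N ^ r * ∫⁻ s, k s ^ r) := by gcongr
      _ = _ := by ring
  have hQ : ∫⁻ x, (∫⁻ z, h z * crossMass F G ν (x + z) 0) ^ r ≤ (∫⁻ z, h z ^ r) * N ^ r := by
    have := lintegral_rpow_lintegral_mul_le (μ := volume) hr
      (A := fun x z => crossMass F G ν (x + z) 0)
      (mc0.comp (by fun_prop : Measurable fun w : ℝ × ℝ => w.1 + w.2)) hh (M := N) (N := N)
      (fun x => (lintegral_add_left_eq_self (fun z => crossMass F G ν z 0) x).trans_le (b1 0))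
      (fun z => (lintegral_shift (fun x => crossMass F G ν x 0) z).trans_le (b1 0))
    rw [hN, mul_comm] at this
    simpa only [mul_comm] using this
  calc _ ≤ ∫⁻ x, 2 ^ (r - 1) * ((∫⁻ z, h z * D (x + z)) ^ r +
        (∫⁻ z, h z * crossMass F G ν (x + z) 0) ^ r) := by
        refine lintegral_mono fun x => ?_
        rw [show (∫⁻ z, h z * (D (x + z) + crossMass F G ν (x + z) 0)) =
          (∫⁻ z, h z * D (x + z)) + ∫⁻ z, h z * crossMass F G ν (x + z) 0 by
            simp only [mul_add]
            exact lintegral_add_left (hh.mul (mD.comp (measurable_const_add x))) _]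
        exact ENNReal.rpow_add_le_mul_rpow_add_rpow _ _ hr.le
    _ = 2 ^ (r - 1) * ((∫⁻ x, (∫⁻ z, h z * D (x + z)) ^ r) +
        ∫⁻ x, (∫⁻ z, h z * crossMass F G ν (x + z) 0) ^ r) := by
        have m1 : Measurable fun x => (∫⁻ z, h z * D (x + z)) ^ r :=
          (Measurable.lintegral_prod_right' (f := fun w : ℝ × ℝ => h w.2 * D (w.1 + w.2))
            ((hh.comp measurable_snd).mul (mD.comp (by fun_prop)))).pow_const r
        have m2 : Measurable fun x => (∫⁻ z, h z * crossMass F G ν (x + z) 0) ^ r :=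
          (Measurable.lintegral_prod_right'
            (f := fun w : ℝ × ℝ => h w.2 * crossMass F G ν (w.1 + w.2) 0)
            ((hh.comp measurable_snd).mul (mc0.comp (by fun_prop : Measurable
              fun w : ℝ × ℝ => w.1 + w.2)))).pow_const r
        rw [← lintegral_add_left m1]
        exact lintegral_const_mul _ (m1.add m2)
    _ ≤ _ := by
        rw [mul_assoc, add_mul]
        gcongr

theorem e2pi_add (a b : ℝ) : e2pi (a + b) = e2pi a * e2pi b := by
  simp only [e2pi, ← Complex.exp_add]
  congr 1
  push_cast
  ring

@[simp] theorem norm_e2pi (a : ℝ) : ‖e2pi a‖ = 1 := by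
  rw [e2pi, show 2 * (Real.pi : ℂ) * Complex.I * a = (2 * Real.pi * a : ℝ) * Complex.I by
    push_cast; ring]
  exact Complex.norm_exp_ofReal_mul_I _

@[fun_prop] theorem continuous_e2pi : Continuous e2pi := by
  unfold e2pi
  fun_prop

@[fun_prop] theorem Continuous.e2pi_comp {X : Type*} [TopologicalSpace X] {u : X → ℝ}
    (hu : Continuous u) : Continuous fun x => e2pi (u x) :=
  continuous_e2pi.comp hu

@[fun_prop] theorem Continuous.gauss1_comp {X : Type*} [TopologicalSpace X] {u : X → ℝ}
    (hu : Continuous u) : Continuous fun x => gauss1 (u x) := by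
  unfold gauss1
  fun_prop

theorem norm_gauss1 (x : ℝ) : ‖gauss1 x‖ = Real.exp (-x ^ 2) := by
  rw [gauss1, Complex.norm_real, Real.norm_eq_abs, Real.abs_exp]

theorem norm_gauss1_le_one (x : ℝ) : ‖gauss1 x‖ ≤ 1 := by
  rw [norm_gauss1, Real.exp_le_one_iff]
  nlinarith [sq_nonneg x]

theorem integrable_gauss1 : Integrable gauss1 := by
  have := (integrable_exp_neg_mul_sq (b := 1) one_pos).ofReal (𝕜 := ℂ)
  unfold gauss1
  simpa using this

theorem FT1_eq_fourier (f : ℝ → ℂ) : FT1 f = FourierTransform.fourier f := by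
  funext ξ
  rw [FT1, Real.fourier_eq']
  refine integral_congr_ae (Filter.Eventually.of_forall fun y => ?_)
  simp only [e2pi, smul_eq_mul]
  rw [mul_comm]
  congr 2
  simp
  ring

theorem eq_integral_FT1 {f : ℝ → ℂ} (hc : Continuous f) (hf : Integrable f)
    (hf' : Integrable (FT1 f)) (y : ℝ) : f y = ∫ ξ, FT1 f ξ * e2pi (y * ξ) := by
  rw [FT1_eq_fourier] at *
  conv_lhs => rw [← hc.fourierInv_fourier_eq hf hf']
  rw [Real.fourierInv_eq']
  refine integral_congr_ae (Filter.Eventually.of_forall fun ξ => ?_)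
  simp only [e2pi, smul_eq_mul]
  rw [mul_comm]
  congr 2
  simp
  ring

theorem integrable_FT1_schwartz (f : SchwartzMap ℝ ℂ) : Integrable (FT1 f) := by
  rw [FT1_eq_fourier, ← SchwartzMap.fourier_coe]
  exact SchwartzMap.integrable _

theorem continuous_FT1_schwartz (f : SchwartzMap ℝ ℂ) : Continuous (FT1 f) := by
  rw [FT1_eq_fourier, ← SchwartzMap.fourier_coe]
  exact SchwartzMap.continuous _

theorem integral_gaussian_mul_e2pi {b : ℝ} (hb : 0 < b) (s : ℝ) :
    ∫ u : ℝ, (Real.exp (-b * u ^ 2) : ℂ) * e2pi (u * s) =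
      (∫ u : ℝ, Real.exp (-b * u ^ 2) : ℝ) * (Real.exp (-(Real.pi ^ 2 / b) * s ^ 2) : ℂ) := by
  have hb' : 0 < (b : ℂ).re := by simpa using hb
  have hb0 : (b : ℂ) ≠ 0 := by exact_mod_cast hb.ne'
  have h1 := fourierIntegral_gaussian hb' (2 * Real.pi * s)
  have h0 := fourierIntegral_gaussian hb' 0
  have e0 : ((∫ u : ℝ, Real.exp (-b * u ^ 2) : ℝ) : ℂ) = (Real.pi / (b : ℂ)) ^ (1 / 2 : ℂ) := by
    rw [← integral_complex_ofReal]
    simpa using h0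
  rw [e0]
  convert h1 using 2
  · funext u
    rw [mul_comm, e2pi]
    congr 1
    · congr 1
      push_cast
      ring
    · push_cast; rfl
  · push_cast
    congr 1
    field_simp
    ring

theorem continuous_STFT1 {f : ℝ → ℂ} (hf : Integrable f) :
    Continuous fun z : ℝ × ℝ => STFT1 gauss1 f z.1 z.2 := by
  unfold STFT1
  refine continuous_of_dominated (bound := fun y => ‖f y‖) (fun z => ?_) (fun z => ?_) hf.norm ?_
  · exact (hf.aestronglyMeasurable.mul (by fun_prop : Continuous fun y =>
      e2pi (-(y * z.2))).aestronglyMeasurable).mul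
      (by fun_prop : Continuous fun y => gauss1 (y - z.1)).aestronglyMeasurable
  · refine Filter.Eventually.of_forall fun y => ?_
    rw [norm_mul, norm_mul, norm_e2pi, mul_one]
    exact mul_le_of_le_one_right (norm_nonneg _) (norm_gauss1_le_one _)
  · exact Filter.Eventually.of_forall fun y => by fun_prop

theorem STFT1_eq_FT1 (f : ℝ → ℂ) (t ξ : ℝ) :
    STFT1 gauss1 f t ξ = FT1 (fun y => f y * gauss1 (y - t)) ξ := by
  rw [STFT1, FT1]
  congr 1
  funext y
  ring

theorem integrable_FT1_gauss1_shift (t : ℝ) : Integrable (FT1 fun y => gauss1 (y - t)) := by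
  have h : ∀ w, FT1 (fun y => gauss1 (y - t)) w =
      e2pi (-(t * w)) * ((∫ u : ℝ, Real.exp (-1 * u ^ 2) : ℝ) *
        (Real.exp (-(Real.pi ^ 2 / 1) * w ^ 2) : ℂ)) := by
    intro w
    have := integral_gaussian_mul_e2pi one_pos (-w)
    rw [neg_sq] at this
    rw [← this, FT1, ← integral_add_right_eq_self _ t, ← integral_const_mul]
    congr 1
    funext u
    rw [show -((u + t) * w) = -(t * w) + u * -w by ring, e2pi_add, gauss1]
    simp only [add_sub_cancel_right, neg_one_mul]
    ring
  rw [funext h]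
  have hi : Integrable fun w : ℝ => (Real.exp (-(Real.pi ^ 2 / 1) * w ^ 2) : ℂ) :=
    (integrable_exp_neg_mul_sq (by positivity)).ofReal
  refine (hi.const_mul _).bdd_mul (c := 1) (by fun_prop) ?_
  exact Filter.Eventually.of_forall fun w => (norm_e2pi _).le

theorem integrable_STFT1 (f : SchwartzMap ℝ ℂ) (t : ℝ) : Integrable (STFT1 gauss1 f t) := by
  have hφ : Integrable fun y => gauss1 (y - t) := integrable_gauss1.comp_sub_right t
  have h : ∀ ξ, STFT1 gauss1 f t ξ =
      ∫ η, FT1 f η * FT1 (fun y => gauss1 (y - t)) (ξ - η) := by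
    intro ξ
    have hi : Integrable (Function.uncurry fun y η : ℝ =>
        gauss1 (y - t) * FT1 f η * (e2pi (y * η) * e2pi (-(y * ξ)))) (volume.prod volume) := by
      refine (hφ.mul_prod (integrable_FT1_schwartz f)).mul_bdd (c := 1) ?_ ?_
      · exact (by fun_prop : Continuous fun z : ℝ × ℝ =>
          e2pi (z.1 * z.2) * e2pi (-(z.1 * ξ))).aestronglyMeasurable
      · exact Filter.Eventually.of_forall fun z => by simp
    calc STFT1 gauss1 f t ξ
        = ∫ y, ∫ η, gauss1 (y - t) * FT1 f η * (e2pi (y * η) * e2pi (-(y * ξ))) := by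
          rw [STFT1]
          congr 1
          funext y
          rw [eq_integral_FT1 f.continuous f.integrable (integrable_FT1_schwartz f) y, mul_assoc,
            ← integral_mul_const]
          congr 1
          funext η
          ring
      _ = ∫ η, ∫ y, gauss1 (y - t) * FT1 f η * (e2pi (y * η) * e2pi (-(y * ξ))) :=
          integral_integral_swap hi
      _ = _ := by
          congr 1
          funext η
          rw [FT1, FT1, ← integral_const_mul]
          congr 1
          funext y
          rw [show -(y * (ξ - η)) = y * η + -(y * ξ) by ring, e2pi_add]
          ring
  rw [funext h]
  exact ((integrable_FT1_schwartz f).convolution_integrand (ContinuousLinearMap.mul ℂ ℂ)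
    (integrable_FT1_gauss1_shift t)).integral_prod_left

theorem eq_integral_STFT1 (f : SchwartzMap ℝ ℂ) (t y : ℝ) :
    f y * gauss1 (y - t) = ∫ ξ, STFT1 gauss1 f t ξ * e2pi (y * ξ) := by
  have hA : Integrable fun y => f y * gauss1 (y - t) :=
    f.integrable.mul_bdd (c := 1)
      (by fun_prop : Continuous fun y => gauss1 (y - t)).aestronglyMeasurable
      (Filter.Eventually.of_forall fun y => norm_gauss1_le_one _)
  have hc : Continuous fun y => f y * gauss1 (y - t) := f.continuous.mul (by fun_prop)
  have hF : STFT1 gauss1 f t = FT1 fun y => f y * gauss1 (y - t) :=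
    funext fun ξ => STFT1_eq_FT1 f t ξ
  have hi := integrable_STFT1 f t
  rw [hF] at hi ⊢
  exact eq_integral_FT1 hc hA hi y

/-- Windowed time-frequency correlation `∫ f(y-s) g(y+s) e^{-2πi y ν} e^{-2(y-x)²} dy`. -/
def windowedCorr (f g : ℝ → ℂ) (x ν s : ℝ) : ℂ :=
  ∫ y : ℝ, f (y - s) * g (y + s) * e2pi (-(y * ν)) * gauss1 (y - x) ^ 2

theorem enorm_windowedCorr_le (f g : SchwartzMap ℝ ℂ) (x ν s : ℝ) :
    ‖windowedCorr f g x ν s‖ₑ ≤ crossMass (fun t ξ => ‖STFT1 gauss1 f t ξ‖ₑ)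
      (fun t ξ => ‖STFT1 gauss1 g t ξ‖ₑ) ν x s := by
  have hB : Integrable fun y => g (y + s) * gauss1 (y - x) :=
    (g.integrable.comp_add_right s).mul_bdd (c := 1)
      (by fun_prop : Continuous fun y => gauss1 (y - x)).aestronglyMeasurable
      (Filter.Eventually.of_forall fun y => norm_gauss1_le_one _)
  have key : windowedCorr f g x ν s = ∫ ξ, STFT1 gauss1 f (x - s) ξ *
      (e2pi (-(s * ξ)) * (e2pi (s * (ν - ξ)) * STFT1 gauss1 g (x + s) (ν - ξ))) := by
    have hi : Integrable (Function.uncurry fun y ξ : ℝ =>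
        (g (y + s) * gauss1 (y - x)) * STFT1 gauss1 f (x - s) ξ *
          (e2pi ((y - s) * ξ) * e2pi (-(y * ν)))) (volume.prod volume) := by
      refine (hB.mul_prod (integrable_STFT1 f (x - s))).mul_bdd (c := 1) ?_ ?_
      · exact (by fun_prop : Continuous fun z : ℝ × ℝ =>
          e2pi ((z.1 - s) * z.2) * e2pi (-(z.1 * ν))).aestronglyMeasurable
      · exact Filter.Eventually.of_forall fun z => by simp
    calc windowedCorr f g x ν s
        = ∫ y, ∫ ξ, (g (y + s) * gauss1 (y - x)) * STFT1 gauss1 f (x - s) ξ *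
          (e2pi ((y - s) * ξ) * e2pi (-(y * ν))) := by
          rw [windowedCorr]
          congr 1
          funext y
          have h := eq_integral_STFT1 f (x - s) (y - s)
          rw [show y - s - (x - s) = y - x by ring] at h
          calc _ = (f (y - s) * gauss1 (y - x)) *
                (g (y + s) * gauss1 (y - x) * e2pi (-(y * ν))) := by ring
            _ = _ := by
              rw [h, ← integral_mul_const]
              congr 1
              funext ξ
              ring
      _ = ∫ ξ, ∫ y, (g (y + s) * gauss1 (y - x)) * STFT1 gauss1 f (x - s) ξ *
          (e2pi ((y - s) * ξ) * e2pi (-(y * ν))) := integral_integral_swap hi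
      _ = _ := by
          congr 1
          funext ξ
          rw [STFT1.eq_1 _ g, ← integral_add_right_eq_self
            (fun y => g y * e2pi (-(y * (ν - ξ))) * gauss1 (y - (x + s))) s,
            ← integral_const_mul, ← integral_const_mul, ← integral_const_mul]
          congr 1
          funext y
          rw [show y + s - (x + s) = y - x by ring, show (y - s) * ξ = y * ξ + -(s * ξ) by ring,
            e2pi_add, show -(y * ν) = -(y * ξ) + (s * (ν - ξ) + -((y + s) * (ν - ξ))) by ring,
            e2pi_add, e2pi_add (s * (ν - ξ))]
          have : e2pi (y * ξ) * e2pi (-(y * ξ)) = 1 := by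
            rw [← e2pi_add, add_neg_cancel, e2pi]; simp
          linear_combination (g (y + s) * gauss1 (y - x) * STFT1 gauss1 f (x - s) ξ *
            e2pi (-(s * ξ)) * e2pi (s * (ν - ξ)) * e2pi (-((y + s) * (ν - ξ)))) * this
  rw [key]
  refine (enorm_integral_le_lintegral_enorm _).trans_eq ?_
  refine lintegral_congr fun ξ => ?_
  have he (a : ℝ) : ‖e2pi a‖ₑ = 1 := by rw [← ofReal_norm, norm_e2pi, ENNReal.ofReal_one]
  simp [enorm_mul, he]

theorem integral_windowedCorr_gaussian (f g : SchwartzMap ℝ ℂ) (x ν η : ℝ) :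
    ∫ s, windowedCorr f g x ν s * e2pi (s * η) * (Real.exp (-2 * s ^ 2) : ℂ) =
      2⁻¹ * (STFT1 gauss1 f x ((ν + η) / 2) * STFT1 gauss1 g x ((ν - η) / 2)) := by
  set H : ℝ → ℝ → ℂ := fun u v => f u * g v * e2pi (-(u * ((ν + η) / 2))) *
    e2pi (-(v * ((ν - η) / 2))) * gauss1 (u - x) * gauss1 (v - x) with hH
  have hgauss (s u : ℝ) : gauss1 (u - x) * gauss1 (u + 2 * s - x) =
      gauss1 (u + s - x) ^ 2 * (Real.exp (-2 * s ^ 2) : ℂ) := by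
    simp only [gauss1]
    norm_cast
    rw [← Real.exp_add, ← Real.exp_nat_mul, ← Real.exp_add]
    congr 1
    push_cast
    ring
  have hi : Integrable (Function.uncurry fun s u : ℝ => H u (2 * s + u))
      (volume.prod volume) := by
    obtain ⟨C, hC⟩ : ∃ C, ∀ v, ‖g v‖ ≤ C := ⟨_, g.norm_le_seminorm ℝ⟩
    have h1 : Integrable fun s : ℝ => (Real.exp (-2 * s ^ 2) : ℂ) :=
      (integrable_exp_neg_mul_sq two_pos).ofReal
    have h2 := (h1.mul_prod (f.integrable (μ := volume))).mul_bdd (c := C * 1 * 1)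
      (g := fun z : ℝ × ℝ => g (2 * z.1 + z.2) * (e2pi (-(z.2 * ((ν + η) / 2))) *
      e2pi (-((2 * z.1 + z.2) * ((ν - η) / 2)))) * gauss1 (z.2 + z.1 - x) ^ 2) ?_ ?_
    · refine h2.congr (Filter.Eventually.of_forall fun z => ?_)
      have := hgauss z.1 z.2
      simp only [Function.uncurry, hH]
      rw [show 2 * z.1 + z.2 = z.2 + 2 * z.1 by ring]
      linear_combination (-f z.2 * g (z.2 + 2 * z.1) * e2pi (-(z.2 * ((ν + η) / 2))) *
        e2pi (-((z.2 + 2 * z.1) * ((ν - η) / 2)))) * this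
    · exact (((g.continuous.comp (by fun_prop : Continuous fun z : ℝ × ℝ => 2 * z.1 + z.2)).mul
        (by fun_prop)).mul (by fun_prop)).aestronglyMeasurable
    · refine Filter.Eventually.of_forall fun z => ?_
      simp only [norm_mul, norm_e2pi, norm_pow, mul_one]
      exact (mul_le_mul (hC _) (pow_le_one₀ (norm_nonneg _) (norm_gauss1_le_one _))
        (by positivity) ((norm_nonneg _).trans (hC 0))).trans_eq (mul_one C)
  calc _ = ∫ s, ∫ u, H u (2 * s + u) := by
        congr 1
        funext s
        rw [windowedCorr, ← integral_add_right_eq_self _ s, ← integral_mul_const,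
          ← integral_mul_const]
        congr 1
        funext u
        simp only [hH]
        have := hgauss s u
        rw [add_sub_cancel_right, show u + s + s = 2 * s + u by ring]
        rw [show u + 2 * s = 2 * s + u by ring] at this
        have he : e2pi (-((u + s) * ν)) * e2pi (s * η) = e2pi (-(u * ((ν + η) / 2))) *
            e2pi (-((2 * s + u) * ((ν - η) / 2))) := by
          rw [← e2pi_add, ← e2pi_add]
          congr 1
          ring
        linear_combination (f u * g (2 * s + u) * gauss1 (u + s - x) ^ 2 *
          (Real.exp (-2 * s ^ 2) : ℂ)) * he - (f u * g (2 * s + u) *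
            e2pi (-(u * ((ν + η) / 2))) * e2pi (-((2 * s + u) * ((ν - η) / 2)))) * this
    _ = ∫ u, ∫ s, H u (2 * s + u) := integral_integral_swap hi
    _ = ∫ u, 2⁻¹ * ∫ v, H u v := by
        congr 1
        funext u
        rw [Measure.integral_comp_mul_left (fun w => H u (w + u)) 2,
          integral_add_right_eq_self (H u) u]
        simp
    _ = _ := by
        rw [integral_const_mul, STFT1, STFT1, ← integral_mul_const]
        congr 2
        funext u
        rw [← integral_const_mul]
        congr 1
        funext v
        simp only [hH]
        ring

theorem norm_integral_e2pi_le (s v : ℝ) :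
    ‖∫ ζ in (0 : ℝ)..v, e2pi (s * ζ)‖ ≤ 2 * (1 + |v|) * (1 + |s|)⁻¹ := by
  have h1 : ‖∫ ζ in (0 : ℝ)..v, e2pi (s * ζ)‖ ≤ |v| := by
    simpa using intervalIntegral.norm_integral_le_of_norm_le_const (a := 0) (b := v) (C := 1)
      (f := fun ζ => e2pi (s * ζ)) (fun ζ _ => (norm_e2pi _).le)
  rw [le_mul_inv_iff₀ (by positivity)]
  have hv := abs_nonneg v
  have hs' := abs_nonneg s
  rcases le_or_gt |s| 1 with hs | hs
  · nlinarith [norm_nonneg (∫ ζ in (0 : ℝ)..v, e2pi (s * ζ))]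
  · have hs0 : s ≠ 0 := fun h => by norm_num [h] at hs
    have hc : 2 * (Real.pi : ℂ) * Complex.I * s ≠ 0 := by
      simp [hs0, Real.pi_ne_zero]
    have h2 : ∫ ζ in (0 : ℝ)..v, e2pi (s * ζ) =
        (e2pi (s * v) - e2pi (s * 0)) / (2 * (Real.pi : ℂ) * Complex.I * s) := by
      have := integral_exp_mul_complex (a := 0) (b := v) hc
      simp only [e2pi]
      push_cast
      simpa only [mul_assoc, Complex.ofReal_zero] using this
    have h3 : ‖∫ ζ in (0 : ℝ)..v, e2pi (s * ζ)‖ * |s| ≤ 1 := by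
      rw [h2, norm_div]
      have hn : ‖2 * (Real.pi : ℂ) * Complex.I * s‖ = 2 * Real.pi * |s| := by
        simp [abs_of_pos Real.pi_pos]
      have ht : ‖e2pi (s * v) - e2pi (s * 0)‖ ≤ 2 := by
        refine (norm_sub_le _ _).trans ?_
        norm_num
      rw [hn, div_mul_eq_mul_div, div_le_one (by positivity)]
      have := Real.pi_gt_three
      nlinarith
    nlinarith

theorem measurable_realSign : Measurable Real.sign := by
  unfold Real.sign
  exact Measurable.ite measurableSet_Iio measurable_const
    (Measurable.ite measurableSet_Ioi measurable_const measurable_const)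

theorem norm_realSign_le (x : ℝ) : ‖(Real.sign x : ℂ)‖ ≤ 1 := by
  rw [Complex.norm_real]
  rcases Real.sign_apply_eq x with h | h | h <;> simp [h]

theorem Integrable.sign_mul {Ψ : ℝ → ℂ} (hΨ : Integrable Ψ) (v : ℝ) :
    Integrable fun ζ => (Real.sign (ζ - v) : ℂ) * Ψ ζ :=
  hΨ.bdd_mul (c := 1) (Complex.measurable_ofReal.comp
    (measurable_realSign.comp (measurable_sub_const v))).aestronglyMeasurable
    (Filter.Eventually.of_forall fun _ => norm_realSign_le _)

theorem integral_sign_sub_mul {Ψ : ℝ → ℂ} (hΨ : Integrable Ψ) (v : ℝ) :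
    ∫ ζ, (Real.sign (ζ - v) : ℂ) * Ψ ζ = (∫ ζ, Ψ ζ) - 2 * ∫ ζ in Set.Iic v, Ψ ζ := by
  rw [← integral_indicator measurableSet_Iic, ← integral_const_mul,
    ← integral_sub hΨ ((hΨ.indicator measurableSet_Iic).const_mul 2)]
  refine integral_congr_ae ?_
  filter_upwards [Measure.ae_ne volume v] with ζ hζ
  rcases lt_or_gt_of_ne hζ with h | h
  · rw [Set.indicator_of_mem (Set.mem_Iic.2 h.le), Real.sign_of_neg (by linarith)]
    push_cast
    ring
  · rw [Set.indicator_of_notMem (by simpa using h), Real.sign_of_pos (by linarith)]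
    push_cast
    ring

/-- Changing the jump of the sign costs an integral over a bounded frequency interval. -/
theorem enorm_integral_sign_sub_le {Q : ℝ → ℂ} (hQ : Integrable Q)
    (hΨ : Integrable fun ζ => ∫ s, Q s * e2pi (s * ζ)) (v : ℝ) :
    ‖(∫ ζ, (Real.sign ζ : ℂ) * ∫ s, Q s * e2pi (s * ζ)) -
        ∫ ζ, (Real.sign (ζ - v) : ℂ) * ∫ s, Q s * e2pi (s * ζ)‖ₑ ≤
      ENNReal.ofReal (4 * (1 + |v|)) * ∫⁻ s, ‖Q s‖ₑ * ENNReal.ofReal ((1 + |s|)⁻¹) := by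
  have h0 := integral_sign_sub_mul hΨ 0
  simp only [sub_zero] at h0
  have hi : Integrable (Function.uncurry fun ζ s : ℝ => Q s * e2pi (s * ζ))
      ((volume.restrict (Set.uIoc 0 v)).prod volume) := by
    have h1 : Integrable (fun _ : ℝ => (1 : ℂ)) (volume.restrict (Set.uIoc 0 v)) := by
      simp [Set.uIoc]
    refine ((h1.mul_prod hQ).mul_bdd (c := 1) (g := fun z : ℝ × ℝ => e2pi (z.2 * z.1)) ?_ ?_).congr
      (Filter.Eventually.of_forall fun z => ?_)
    · exact (by fun_prop : Continuous fun z : ℝ × ℝ => e2pi (z.2 * z.1)).aestronglyMeasurable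
    · exact Filter.Eventually.of_forall fun z => (norm_e2pi _).le
    · simp [Function.uncurry]
  rw [h0, integral_sign_sub_mul hΨ v, show ∀ a b c : ℂ, a - 2 * b - (a - 2 * c) = 2 * (c - b) by
    intros; ring, intervalIntegral.integral_Iic_sub_Iic hΨ.integrableOn hΨ.integrableOn,
    intervalIntegral_integral_swap hi]
  rw [← integral_const_mul, ← lintegral_const_mul' _ _ ENNReal.ofReal_ne_top]
  refine (enorm_integral_le_lintegral_enorm _).trans (lintegral_mono fun s => ?_)
  rw [intervalIntegral.integral_const_mul, mul_left_comm, enorm_mul, mul_left_comm]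
  gcongr
  rw [← ofReal_norm, ← ENNReal.ofReal_mul (by positivity)]
  refine ENNReal.ofReal_le_ofReal ?_
  rw [norm_mul]
  have := norm_integral_e2pi_le s v
  norm_num
  linarith

/-- The sign multiplier is controlled by a slowly decaying kernel and a Gaussian-localised part. -/
theorem exists_enorm_integral_sign_le : ∃ C : ℝ≥0∞, C ≠ ∞ ∧ ∀ Q : ℝ → ℂ, Integrable Q →
    Integrable (fun ζ => ∫ s, Q s * e2pi (s * ζ)) →
    ‖∫ ζ, (Real.sign ζ : ℂ) * ∫ s, Q s * e2pi (s * ζ)‖ₑ ≤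
      C * (∫⁻ s, ‖Q s‖ₑ * ENNReal.ofReal ((1 + |s|)⁻¹)) +
      ∫⁻ η, ‖∫ s, Q s * e2pi (s * η) * (Real.exp (-2 * s ^ 2) : ℂ)‖ₑ := by
  set b : ℝ := Real.pi ^ 2 / 2 with hb
  have hb0 : 0 < b := by positivity
  set c : ℝ := ∫ u : ℝ, Real.exp (-b * u ^ 2) with hc
  have hc0 : 0 < c := by
    rw [hc, integral_gaussian]
    positivity
  have hg : Integrable fun u : ℝ => Real.exp (-b * u ^ 2) := integrable_exp_neg_mul_sq hb0
  have hgc : Integrable fun u : ℝ => (Real.exp (-b * u ^ 2) : ℂ) := hg.ofReal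
  have hg1 : Integrable fun u : ℝ => Real.exp (-b * u ^ 2) * (4 * (1 + |u|)) := by
    have h1 := (integrable_mul_exp_neg_mul_sq hb0).norm
    refine ((hg.add h1).const_mul 4).congr (Filter.Eventually.of_forall fun u => ?_)
    simp only [Pi.add_apply, norm_mul, Real.norm_eq_abs, Real.abs_exp]
    ring
  refine ⟨ENNReal.ofReal c⁻¹ * ∫⁻ u, ENNReal.ofReal (Real.exp (-b * u ^ 2) * (4 * (1 + |u|))),
    ENNReal.mul_ne_top ENNReal.ofReal_ne_top hg1.lintegral_lt_top.ne, fun Q hQ hΨ => ?_⟩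
  set Ψ : ℝ → ℂ := fun ζ => ∫ s, Q s * e2pi (s * ζ) with hΨd
  set S : ℝ → ℂ := fun v => ∫ ζ, (Real.sign (ζ - v) : ℂ) * Ψ ζ with hS
  set Z : ℝ → ℂ := fun η => ∫ s, Q s * e2pi (s * η) * (Real.exp (-2 * s ^ 2) : ℂ) with hZ
  set T : ℂ := ∫ ζ, (Real.sign ζ : ℂ) * Ψ ζ with hT
  have hFub : Integrable fun z : ℝ × ℝ =>
      (Real.exp (-b * z.2 ^ 2) : ℂ) * ((Real.sign z.1 : ℂ) * Ψ (z.1 - z.2)) := by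
    have h1 := hgc.convolution_integrand (ContinuousLinearMap.mul ℂ ℂ) hΨ
    refine (h1.bdd_mul (c := 1) (f := fun z : ℝ × ℝ => (Real.sign z.1 : ℂ)) ?_ ?_).congr
      (Filter.Eventually.of_forall fun z => ?_)
    · exact (Complex.measurable_ofReal.comp
        (measurable_realSign.comp measurable_fst)).aestronglyMeasurable
    · exact Filter.Eventually.of_forall fun z => norm_realSign_le _
    · simp only [ContinuousLinearMap.mul_apply']
      ring
  have hSneg (u : ℝ) : S (-u) = ∫ η, (Real.sign η : ℂ) * Ψ (η - u) := by
    simp only [hS]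
    rw [← integral_sub_right_eq_self _ u]
    congr 1
    funext η
    congr 3
    ring
  have hGS : Integrable fun u => (Real.exp (-b * u ^ 2) : ℂ) * S (-u) := by
    refine hFub.integral_prod_right.congr (Filter.Eventually.of_forall fun u => ?_)
    simp only
    rw [integral_const_mul, hSneg]
  have hGZ (η : ℝ) : ∫ u, (Real.exp (-b * u ^ 2) : ℂ) * Ψ (η - u) = c * Z η := by
    have hi : Integrable (Function.uncurry fun u s : ℝ =>
        (Real.exp (-b * u ^ 2) : ℂ) * Q s * e2pi (s * (η - u))) (volume.prod volume) :=
      (hgc.mul_prod hQ).mul_bdd (c := 1) (by fun_prop : Continuous fun z : ℝ × ℝ =>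
        e2pi (z.2 * (η - z.1))).aestronglyMeasurable
        (Filter.Eventually.of_forall fun z => (norm_e2pi _).le)
    calc _ = ∫ u, ∫ s, (Real.exp (-b * u ^ 2) : ℂ) * Q s * e2pi (s * (η - u)) := by
          simp only [hΨd, ← integral_const_mul, mul_assoc]
      _ = ∫ s, ∫ u, (Real.exp (-b * u ^ 2) : ℂ) * Q s * e2pi (s * (η - u)) :=
          integral_integral_swap hi
      _ = _ := by
          rw [hZ, ← integral_const_mul]
          congr 1
          funext s
          have := integral_gaussian_mul_e2pi hb0 (-s)
          rw [neg_sq, show Real.pi ^ 2 / b = 2 by rw [hb]; field_simp] at this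
          calc _ = ∫ u, Q s * e2pi (s * η) * ((Real.exp (-b * u ^ 2) : ℂ) * e2pi (u * -s)) := by
                congr 1
                funext u
                rw [show s * (η - u) = s * η + u * -s by ring, e2pi_add]
                ring
            _ = _ := by
                rw [integral_const_mul, this]
                ring
  have hsplit : (c : ℂ) * T = (∫ u, (Real.exp (-b * u ^ 2) : ℂ) * (T - S (-u))) +
      c * ∫ η, (Real.sign η : ℂ) * Z η := by
    have h1 : ∫ u, (Real.exp (-b * u ^ 2) : ℂ) * S (-u) =
        c * ∫ η, (Real.sign η : ℂ) * Z η := by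
      calc _ = ∫ u, ∫ η, (Real.exp (-b * u ^ 2) : ℂ) * ((Real.sign η : ℂ) * Ψ (η - u)) := by
            congr 1
            funext u
            rw [hSneg, integral_const_mul]
        _ = ∫ η, ∫ u, (Real.exp (-b * u ^ 2) : ℂ) * ((Real.sign η : ℂ) * Ψ (η - u)) :=
            (integral_integral_swap hFub).symm
        _ = _ := by
            rw [← integral_const_mul]
            congr 1
            funext η
            rw [mul_left_comm, ← hGZ, ← integral_const_mul]
            congr 1
            funext u
            ring
    rw [← h1, ← integral_add]
    · simp only [mul_sub, sub_add_cancel]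
      rw [integral_mul_const, integral_complex_ofReal]
    · simp only [mul_sub]
      exact (hgc.mul_const T).sub hGS
    · exact hGS
  set I := ∫⁻ s, ‖Q s‖ₑ * ENNReal.ofReal ((1 + |s|)⁻¹) with hI
  have hA : ‖∫ u, (Real.exp (-b * u ^ 2) : ℂ) * (T - S (-u))‖ₑ ≤
      (∫⁻ u, ENNReal.ofReal (Real.exp (-b * u ^ 2) * (4 * (1 + |u|)))) * I := by
    refine (enorm_integral_le_lintegral_enorm _).trans ?_
    rw [← lintegral_mul_const'' _ hg1.aemeasurable.ennreal_ofReal]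
    refine lintegral_mono fun u => ?_
    have := enorm_integral_sign_sub_le hQ hΨ (-u)
    rw [abs_neg] at this
    rw [enorm_mul, ENNReal.ofReal_mul (Real.exp_nonneg _), mul_assoc]
    refine mul_le_mul' (le_of_eq ?_) this
    rw [← ofReal_norm, Complex.norm_real, Real.norm_eq_abs, Real.abs_exp]
  have hB : ‖∫ η, (Real.sign η : ℂ) * Z η‖ₑ ≤ ∫⁻ η, ‖Z η‖ₑ := by
    refine (enorm_integral_le_lintegral_enorm _).trans (lintegral_mono fun η => ?_)
    rw [enorm_mul]
    refine mul_le_of_le_one_left' ?_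
    rw [← ofReal_norm]
    exact ENNReal.ofReal_le_one.2 (norm_realSign_le η)
  have hT' : T = (c⁻¹ : ℝ) * (∫ u, (Real.exp (-b * u ^ 2) : ℂ) * (T - S (-u))) +
      ∫ η, (Real.sign η : ℂ) * Z η := by
    have hcc : (c : ℂ) ≠ 0 := by exact_mod_cast hc0.ne'
    have e : T = (c : ℂ)⁻¹ * (c * T) := by field_simp
    rw [hsplit, mul_add, inv_mul_cancel_left₀ hcc] at e
    rw [Complex.ofReal_inv]
    exact e
  rw [hT']
  refine (enorm_add_le _ _).trans (add_le_add ?_ hB)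
  rw [enorm_mul, mul_assoc]
  refine mul_le_mul' (le_of_eq ?_) hA
  rw [← ofReal_norm, Complex.norm_real, Real.norm_of_nonneg (by positivity)]

theorem norm_FT1_le (f : ℝ → ℂ) (ξ : ℝ) : ‖FT1 f ξ‖ ≤ ∫ y, ‖f y‖ := by
  rw [FT1]
  refine (norm_integral_le_integral_norm _).trans_eq ?_
  simp

theorem integral_FT1_shift_mul_FT1 (f g : SchwartzMap ℝ ℂ) (y ζ : ℝ) :
    ∫ ξ, FT1 f (ξ + ζ) * FT1 g ξ * e2pi (y * (2 * ξ + ζ)) =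
      ∫ s, f (y - s) * g (y + s) * e2pi (s * ζ) := by
  have hi : Integrable (Function.uncurry fun ξ u : ℝ =>
      FT1 g ξ * f u * (e2pi (-(u * (ξ + ζ))) * e2pi (y * (2 * ξ + ζ))))
      (volume.prod volume) := by
    refine ((integrable_FT1_schwartz g).mul_prod (f.integrable (μ := volume))).mul_bdd (c := 1)
      ?_ ?_
    · exact (by fun_prop : Continuous fun z : ℝ × ℝ =>
        e2pi (-(z.2 * (z.1 + ζ))) * e2pi (y * (2 * z.1 + ζ))).aestronglyMeasurable
    · exact Filter.Eventually.of_forall fun z => by simp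
  calc _ = ∫ ξ, ∫ u, FT1 g ξ * f u * (e2pi (-(u * (ξ + ζ))) * e2pi (y * (2 * ξ + ζ))) := by
        congr 1
        funext ξ
        rw [FT1.eq_1 f, mul_assoc, ← integral_mul_const]
        congr 1
        funext u
        ring
    _ = ∫ u, ∫ ξ, FT1 g ξ * f u * (e2pi (-(u * (ξ + ζ))) * e2pi (y * (2 * ξ + ζ))) :=
        integral_integral_swap hi
    _ = ∫ u, f u * g (2 * y - u) * e2pi ((y - u) * ζ) := by
        congr 1
        funext u
        rw [eq_integral_FT1 g.continuous g.integrable (integrable_FT1_schwartz g) (2 * y - u),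
          mul_assoc, ← integral_mul_const, ← integral_const_mul]
        congr 1
        funext ξ
        have he : e2pi (-(u * (ξ + ζ))) * e2pi (y * (2 * ξ + ζ)) =
            e2pi ((2 * y - u) * ξ) * e2pi ((y - u) * ζ) := by
          rw [← e2pi_add, ← e2pi_add]
          congr 1
          ring
        linear_combination (f u * FT1 g ξ) * he
    _ = _ := by
        rw [← integral_sub_left_eq_self _ volume y]
        congr 1
        funext s
        rw [show 2 * y - (y - s) = y + s by ring, sub_sub_cancel]

/-- The volume preserving map `(ξ, ζ) ↦ (ξ + ζ, ξ)`. -/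
def freqShear : ℝ × ℝ ≃ᵐ ℝ × ℝ := (MeasurableEquiv.shearAddRight ℝ).trans MeasurableEquiv.prodComm

theorem measurePreserving_freqShear : MeasurePreserving freqShear :=
  Measure.measurePreserving_swap.comp (measurePreserving_prod_add volume volume)

theorem integrable_FT1_freqShear (f g : SchwartzMap ℝ ℂ) :
    Integrable fun z : ℝ × ℝ => FT1 f (z.1 + z.2) * FT1 g z.1 :=
  measurePreserving_freqShear.integrable_comp_of_integrable
    ((integrable_FT1_schwartz f).mul_prod (integrable_FT1_schwartz g))

theorem BH_eq_integral_freqShear (f g : SchwartzMap ℝ ℂ) (y : ℝ) :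
    BH f g y = -Real.pi * Complex.I * ∫ z : ℝ × ℝ, (Real.sign z.2 : ℂ) *
      (FT1 f (z.1 + z.2) * FT1 g z.1 * e2pi (y * (2 * z.1 + z.2))) := by
  rw [BH, ← measurePreserving_freqShear.integral_comp', ← integral_const_mul]
  congr 1
  funext z
  have h : freqShear z = (z.1 + z.2, z.1) := rfl
  simp only [h, add_sub_cancel_left]
  rw [show z.1 + z.2 + z.1 = 2 * z.1 + z.2 by ring]
  ring

/-- A window transforms the bilinear Hilbert transform into a one-dimensional sign multiplier. -/
theorem integral_BH_mul (f g : SchwartzMap ℝ ℂ) {w : ℝ → ℂ} (hw : Integrable w) :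
    Integrable (fun s => ∫ y, f (y - s) * g (y + s) * w y) ∧
    Integrable (fun ζ => ∫ s, (∫ y, f (y - s) * g (y + s) * w y) * e2pi (s * ζ)) ∧
    ∫ y, BH f g y * w y = -Real.pi * Complex.I * ∫ ζ, (Real.sign ζ : ℂ) *
      ∫ s, (∫ y, f (y - s) * g (y + s) * w y) * e2pi (s * ζ) := by
  obtain ⟨C, hC⟩ : ∃ C, ∀ v, ‖g v‖ ≤ C := ⟨_, g.norm_le_seminorm ℝ⟩
  have hQ : Integrable (fun z : ℝ × ℝ => f (z.2 - z.1) * g (z.2 + z.1) * w z.2)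
      (volume.prod volume) := by
    have h := (hw.convolution_integrand (ContinuousLinearMap.mul ℂ ℂ)
      (f.integrable (μ := volume)).comp_neg).mul_bdd (c := C)
      (g := fun z : ℝ × ℝ => g (z.2 + z.1))
      (g.continuous.comp (by fun_prop : Continuous fun z : ℝ × ℝ => z.2 + z.1)).aestronglyMeasurable
      (Filter.Eventually.of_forall fun z => hC _)
    refine h.congr (Filter.Eventually.of_forall fun z => ?_)
    simp only [ContinuousLinearMap.mul_apply', neg_sub]
    ring
  set a : ℝ × ℝ → ℂ := fun z => FT1 f (z.1 + z.2) * FT1 g z.1 with ha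
  have haI : Integrable a := integrable_FT1_freqShear f g
  have hT : Integrable (fun z : (ℝ × ℝ) × ℝ => a z.1 * w z.2 * e2pi (z.2 * (2 * z.1.1 + z.1.2)))
      (volume.prod volume) :=
    (haI.mul_prod hw).mul_bdd (c := 1) (by fun_prop : Continuous fun z : (ℝ × ℝ) × ℝ =>
      e2pi (z.2 * (2 * z.1.1 + z.1.2))).aestronglyMeasurable
      (Filter.Eventually.of_forall fun z => by simp)
  have hT' : Integrable (fun z : (ℝ × ℝ) × ℝ => (Real.sign z.1.2 : ℂ) *
      (a z.1 * w z.2 * e2pi (z.2 * (2 * z.1.1 + z.1.2)))) (volume.prod volume) :=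
    hT.bdd_mul (c := 1) (Complex.measurable_ofReal.comp
      (measurable_realSign.comp (measurable_snd.comp measurable_fst))).aestronglyMeasurable
      (Filter.Eventually.of_forall fun _ => norm_realSign_le _)
  have hΨ (ζ : ℝ) : ∫ ξ, ∫ y, a (ξ, ζ) * w y * e2pi (y * (2 * ξ + ζ)) =
      ∫ s, (∫ y, f (y - s) * g (y + s) * w y) * e2pi (s * ζ) := by
    have hb : Integrable fun ξ => a (ξ, ζ) :=
      (integrable_FT1_schwartz g).bdd_mul (c := ∫ y, ‖f y‖)
        ((continuous_FT1_schwartz f).comp (continuous_add_const ζ)).aestronglyMeasurable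
        (Filter.Eventually.of_forall fun _ => norm_FT1_le _ _)
    have h1 : Integrable (Function.uncurry fun ξ y : ℝ =>
        a (ξ, ζ) * w y * e2pi (y * (2 * ξ + ζ))) (volume.prod volume) :=
      (hb.mul_prod hw).mul_bdd (c := 1) (by fun_prop : Continuous fun z : ℝ × ℝ =>
        e2pi (z.2 * (2 * z.1 + ζ))).aestronglyMeasurable
        (Filter.Eventually.of_forall fun z => by simp)
    have h2 : Integrable (Function.uncurry fun s y : ℝ =>
        f (y - s) * g (y + s) * w y * e2pi (s * ζ)) (volume.prod volume) :=
      hQ.mul_bdd (c := 1) (by fun_prop : Continuous fun z : ℝ × ℝ =>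
        e2pi (z.1 * ζ)).aestronglyMeasurable (Filter.Eventually.of_forall fun z => by simp)
    calc _ = ∫ y, ∫ ξ, a (ξ, ζ) * w y * e2pi (y * (2 * ξ + ζ)) := integral_integral_swap h1
      _ = ∫ y, ∫ s, f (y - s) * g (y + s) * w y * e2pi (s * ζ) := by
          congr 1
          funext y
          calc _ = w y * ∫ ξ, FT1 f (ξ + ζ) * FT1 g ξ * e2pi (y * (2 * ξ + ζ)) := by
                rw [← integral_const_mul]
                congr 1
                funext ξ
                simp only [ha]
                ring
            _ = _ := by
                rw [integral_FT1_shift_mul_FT1, ← integral_const_mul]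
                congr 1
                funext s
                ring
      _ = ∫ s, ∫ y, f (y - s) * g (y + s) * w y * e2pi (s * ζ) := (integral_integral_swap h2).symm
      _ = _ := by
          congr 1
          funext s
          rw [integral_mul_const]
  refine ⟨hQ.integral_prod_left, ?_, ?_⟩
  · have := hT.integral_prod_left.integral_prod_right
    simpa only [hΨ] using this
  · calc ∫ y, BH f g y * w y
        = ∫ y, -Real.pi * Complex.I * ∫ z : ℝ × ℝ, (Real.sign z.2 : ℂ) *
          (a z * w y * e2pi (y * (2 * z.1 + z.2))) := by
          congr 1
          funext y
          rw [BH_eq_integral_freqShear, mul_assoc, ← integral_mul_const]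
          congr 2
          funext z
          simp only [ha]
          ring
      _ = -Real.pi * Complex.I * ∫ z : ℝ × ℝ, ∫ y, (Real.sign z.2 : ℂ) *
          (a z * w y * e2pi (y * (2 * z.1 + z.2))) := by
          rw [integral_const_mul]
          exact congrArg _ (integral_integral_swap (f := fun y z => (Real.sign z.2 : ℂ) *
            (a z * w y * e2pi (y * (2 * z.1 + z.2)))) hT'.swap)
      _ = _ := by
          rw [Measure.volume_eq_prod, integral_prod_symm _ hT'.integral_prod_left]
          congr 2
          funext ζ
          rw [← hΨ, ← integral_const_mul]
          simp only [integral_const_mul]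

theorem lintegral_comp_half_mul_add {φ : ℝ → ℝ≥0∞} (hφ : Measurable φ) (a : ℝ) :
    ∫⁻ η, φ (2⁻¹ * η + a) = 2 * ∫⁻ ξ, φ ξ := by
  calc _ = ∫⁻ t, φ (t + a) ∂(Measure.map (fun η : ℝ => 2⁻¹ * η) volume) := by
        exact (lintegral_map (f := fun t => φ (t + a)) (hφ.comp (measurable_add_const a))
          (measurable_const_mul _)).symm
    _ = _ := by
        rw [Real.map_volume_mul_left (by norm_num : (2⁻¹ : ℝ) ≠ 0), lintegral_smul_measure,
          lintegral_add_right_eq_self φ]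
        norm_num

theorem lintegral_enorm_integral_windowedCorr (f g : SchwartzMap ℝ ℂ) (ν x : ℝ) :
    ∫⁻ η, ‖∫ s, windowedCorr f g x ν s * e2pi (s * η) * (Real.exp (-2 * s ^ 2) : ℂ)‖ₑ =
      crossMass (fun t ξ => ‖STFT1 gauss1 f t ξ‖ₑ) (fun t ξ => ‖STFT1 gauss1 g t ξ‖ₑ) ν x 0 := by
  have hcf : Continuous (STFT1 gauss1 f x) :=
    Continuous.uncurry_left x (continuous_STFT1 f.integrable)
  have hcg : Continuous (STFT1 gauss1 g x) :=
    Continuous.uncurry_left x (continuous_STFT1 g.integrable)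
  have hm : Measurable fun ξ => ‖STFT1 gauss1 f x ξ‖ₑ * ‖STFT1 gauss1 g x (ν - ξ)‖ₑ :=
    hcf.measurable.enorm.mul (hcg.comp' (continuous_sub_left ν)).measurable.enorm
  have h (η : ℝ) : ‖∫ s, windowedCorr f g x ν s * e2pi (s * η) *
      (Real.exp (-2 * s ^ 2) : ℂ)‖ₑ = ‖(2⁻¹ : ℂ)‖ₑ *
        (‖STFT1 gauss1 f x (2⁻¹ * η + ν / 2)‖ₑ *
          ‖STFT1 gauss1 g x (ν - (2⁻¹ * η + ν / 2))‖ₑ) := by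
    rw [integral_windowedCorr_gaussian, enorm_mul, enorm_mul,
      show (ν + η) / 2 = 2⁻¹ * η + ν / 2 by ring,
      show (ν - η) / 2 = ν - (2⁻¹ * η + ν / 2) by ring]
  have h2 : ‖(2⁻¹ : ℂ)‖ₑ = 2⁻¹ := by
    rw [← ofReal_norm, norm_inv, Complex.norm_ofNat, ENNReal.ofReal_inv_of_pos two_pos,
      ENNReal.ofReal_ofNat]
  simp only [h]
  rw [lintegral_const_mul' _ _ (by simp [h2]), lintegral_comp_half_mul_add hm, h2, ← mul_assoc,
    ENNReal.inv_mul_cancel two_ne_zero ENNReal.ofNat_ne_top, one_mul]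
  simp only [crossMass, sub_zero, add_zero]

theorem exists_enorm_integral_BH_window_le : ∃ C : ℝ≥0∞, C ≠ ∞ ∧
    ∀ (f g : SchwartzMap ℝ ℂ) (ν x : ℝ),
      ‖∫ y, BH f g y * (e2pi (-(y * ν)) * gauss1 (y - x) ^ 2)‖ₑ ≤
        C * ((∫⁻ s, crossMass (fun t ξ => ‖STFT1 gauss1 f t ξ‖ₑ)
          (fun t ξ => ‖STFT1 gauss1 g t ξ‖ₑ) ν x s * ENNReal.ofReal ((1 + |s|)⁻¹)) +
          crossMass (fun t ξ => ‖STFT1 gauss1 f t ξ‖ₑ)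
            (fun t ξ => ‖STFT1 gauss1 g t ξ‖ₑ) ν x 0) := by
  obtain ⟨C, hC, h⟩ := exists_enorm_integral_sign_le
  refine ⟨ENNReal.ofReal Real.pi * (C + 1), by finiteness, fun f g ν x => ?_⟩
  have hw : Integrable fun y => e2pi (-(y * ν)) * gauss1 (y - x) ^ 2 := by
    refine Integrable.bdd_mul (c := 1) ?_ (by fun_prop) (Filter.Eventually.of_forall
      fun _ => (norm_e2pi _).le)
    simp only [sq]
    exact (integrable_gauss1.comp_sub_right x).mul_bdd (c := 1) (by fun_prop)
      (Filter.Eventually.of_forall fun _ => norm_gauss1_le_one _)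
  obtain ⟨h1, h2, h3⟩ := integral_BH_mul f g hw
  have hQ : (fun s => ∫ y, f (y - s) * g (y + s) * (e2pi (-(y * ν)) * gauss1 (y - x) ^ 2)) =
      windowedCorr f g x ν := by
    funext s
    simp only [windowedCorr, mul_assoc]
  have hQ' (s : ℝ) := congrFun hQ s
  simp only [hQ'] at h1 h2 h3
  rw [h3, enorm_mul]
  have hpi : ‖-(Real.pi : ℂ) * Complex.I‖ₑ = ENNReal.ofReal Real.pi := by
    rw [← ofReal_norm]
    simp [abs_of_pos Real.pi_pos]
  rw [hpi, mul_assoc]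
  gcongr
  refine (h _ h1 h2).trans ?_
  rw [lintegral_enorm_integral_windowedCorr, mul_add]
  gcongr
  · exact le_self_add
  · exact enorm_windowedCorr_le f g x ν _
  · rw [add_mul, one_mul]
    exact le_add_self

theorem continuous_BH (f g : SchwartzMap ℝ ℂ) : Continuous (BH f g) := by
  have hi : Integrable fun ξ : ℝ × ℝ => (-(Real.pi : ℂ) * Complex.I *
      (Real.sign (ξ.1 - ξ.2) : ℝ)) * (FT1 f ξ.1 * FT1 g ξ.2) := by
    simp only [mul_assoc (-(Real.pi : ℂ) * Complex.I)]
    exact (((integrable_FT1_schwartz f).mul_prod (integrable_FT1_schwartz g)).bdd_mul (c := 1)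
      (Complex.measurable_ofReal.comp (measurable_realSign.comp
        (measurable_fst.sub measurable_snd))).aestronglyMeasurable
      (Filter.Eventually.of_forall fun _ => norm_realSign_le _)).const_mul _
  unfold BH
  simp only [mul_assoc _ (FT1 f _)]
  refine continuous_of_dominated (fun y => ?_) (fun y => ?_) hi.norm ?_
  · exact hi.aestronglyMeasurable.mul (by fun_prop)
  · exact Filter.Eventually.of_forall fun ξ => by simp
  · exact Filter.Eventually.of_forall fun ξ => by fun_prop

theorem exists_norm_BH_le (f g : ℝ → ℂ) : ∃ M, ∀ y, ‖BH f g y‖ ≤ M :=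
  ⟨_, fun y => (norm_integral_le_integral_norm _).trans_eq (by
    simp only [norm_mul, norm_e2pi, mul_one]; rfl)⟩

theorem integral_gaussian_mul_gauss1_sq (d : ℝ) :
    ∫ z, (Real.exp (-2 * z ^ 2) : ℂ) * gauss1 (d - z) ^ 2 =
      (∫ z, Real.exp (-4 * z ^ 2) : ℝ) * gauss1 d := by
  rw [← integral_complex_ofReal, ← integral_mul_const, ← integral_add_right_eq_self _ (d / 2)]
  congr 1
  funext z
  simp only [gauss1]
  norm_cast
  rw [← Real.exp_nat_mul, ← Real.exp_add, ← Real.exp_add]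
  congr 1
  push_cast
  ring

theorem ofReal_mul_enorm_STFT1_BH_le (f g : SchwartzMap ℝ ℂ) (x ν : ℝ) :
    ENNReal.ofReal (∫ z : ℝ, Real.exp (-4 * z ^ 2)) * ‖STFT1 gauss1 (BH f g) x ν‖ₑ ≤
      ∫⁻ z, ENNReal.ofReal (Real.exp (-2 * z ^ 2)) *
        ‖∫ y, BH f g y * (e2pi (-(y * ν)) * gauss1 (y - (x + z)) ^ 2)‖ₑ := by
  obtain ⟨M, hM⟩ := exists_norm_BH_le f g
  have hc := continuous_BH f g
  have he : Integrable fun z : ℝ => (Real.exp (-2 * z ^ 2) : ℂ) :=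
    (integrable_exp_neg_mul_sq two_pos).ofReal
  have hg : Integrable fun y => gauss1 (y - x) ^ 2 := by
    simp only [sq]
    exact (integrable_gauss1.comp_sub_right x).mul_bdd (c := 1) (by fun_prop)
      (Filter.Eventually.of_forall fun _ => norm_gauss1_le_one _)
  have hi : Integrable (Function.uncurry fun y z : ℝ => (Real.exp (-2 * z ^ 2) : ℂ) *
      gauss1 (y - z - x) ^ 2 * (BH f g y * e2pi (-(y * ν)))) (volume.prod volume) := by
    refine (he.convolution_integrand (ContinuousLinearMap.mul ℂ ℂ) hg).mul_bdd (c := M)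
      (g := fun p : ℝ × ℝ => BH f g p.1 * e2pi (-(p.1 * ν))) ?_ ?_
    · exact (by fun_prop : Continuous fun p : ℝ × ℝ =>
        BH f g p.1 * e2pi (-(p.1 * ν))).aestronglyMeasurable
    · exact Filter.Eventually.of_forall fun p => by simpa using hM p.1
  have key : ((∫ z : ℝ, Real.exp (-4 * z ^ 2) : ℝ) : ℂ) * STFT1 gauss1 (BH f g) x ν =
      ∫ z, (Real.exp (-2 * z ^ 2) : ℂ) *
        ∫ y, BH f g y * (e2pi (-(y * ν)) * gauss1 (y - (x + z)) ^ 2) := by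
    calc _ = ∫ y, ∫ z, (Real.exp (-2 * z ^ 2) : ℂ) *
      gauss1 (y - z - x) ^ 2 * (BH f g y * e2pi (-(y * ν))) := by
          rw [STFT1, ← integral_const_mul]
          congr 1
          funext y
          rw [integral_mul_const]
          simp only [show ∀ z, y - z - x = (y - x) - z from fun z => by ring]
          rw [integral_gaussian_mul_gauss1_sq]
          ring
      _ = ∫ z, ∫ y, (Real.exp (-2 * z ^ 2) : ℂ) *
          gauss1 (y - z - x) ^ 2 * (BH f g y * e2pi (-(y * ν))) := integral_integral_swap hi
      _ = _ := by
          congr 1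
          funext z
          rw [← integral_const_mul]
          congr 1
          funext y
          rw [show y - z - x = y - (x + z) by ring]
          ring
  have hn := congrArg (‖·‖ₑ) key
  simp only [enorm_mul] at hn
  have hr {a : ℝ} (ha : 0 ≤ a) : ‖(a : ℂ)‖ₑ = ENNReal.ofReal a := by
    rw [← ofReal_norm, Complex.norm_of_nonneg ha]
  rw [← hr (integral_nonneg fun z => (Real.exp_pos _).le), hn]
  refine (enorm_integral_le_lintegral_enorm _).trans_eq (lintegral_congr fun z => ?_)
  rw [enorm_mul, hr (Real.exp_pos _).le]

theorem lintegral_gaussian_rpow_ne_top {b r : ℝ} (hb : 0 < b) (hr : 0 < r) :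
    ∫⁻ z : ℝ, ENNReal.ofReal (Real.exp (-b * z ^ 2)) ^ r ≠ ∞ := by
  have h := (integrable_exp_neg_mul_sq (mul_pos hb hr)).lintegral_lt_top
  convert h.ne using 2
  funext z
  rw [ENNReal.ofReal_rpow_of_pos (Real.exp_pos _), ← Real.exp_mul]
  congr 2
  ring

theorem lintegral_one_add_abs_inv_rpow_ne_top {r : ℝ} (hr : 1 < r) :
    ∫⁻ s : ℝ, ENNReal.ofReal ((1 + |s|)⁻¹) ^ r ≠ ∞ := by
  have h := (integrable_one_add_norm (E := ℝ) (μ := volume) (r := r) (by simpa)).lintegral_lt_top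
  convert h.ne using 2
  funext s
  rw [ENNReal.ofReal_rpow_of_pos (by positivity), Real.inv_rpow (by positivity),
    Real.rpow_neg (by positivity), Real.norm_eq_abs]

/-- the bilinear Hilbert transform maps `M^{p,q} × M^{p′,q′}` boundedly
into `M^{1+ε,∞}` for every `ε > 0`. -/
theorem stmt16 (p q p' q' : ℝ≥0∞)
    (hp : 1 ≤ p) (hq : 1 ≤ q) (hp' : 1 ≤ p') (hq' : 1 ≤ q')
    (hpc : 1 / p + 1 / p' = 1) (hqc : 1 / q + 1 / q' = 1)
    (ε : ℝ) (hε : 0 < ε) :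
    ∃ C : ℝ≥0, 0 < C ∧
      ∀ f g : SchwartzMap ℝ ℂ,
        modNorm1 (ENNReal.ofReal (1 + ε)) ∞ (BH (⇑f) (⇑g)) ≤
          (C : ℝ≥0∞) * modNorm1 p q (⇑f) * modNorm1 p' q' (⇑g) := by
  obtain ⟨C, hC, hW⟩ := exists_enorm_integral_BH_window_le
  set r : ℝ := 1 + ε with hr_def
  have hr : 1 < r := by linarith
  have hr0 : 0 < r := by linarith
  set c : ℝ≥0∞ := ENNReal.ofReal (∫ z : ℝ, Real.exp (-4 * z ^ 2)) with hc_def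
  have hc : c ≠ 0 := by
    rw [hc_def, integral_gaussian]
    simp only [ne_eq, ENNReal.ofReal_eq_zero, not_le]
    positivity
  have hc' : c ≠ ∞ := ENNReal.ofReal_ne_top
  set h : ℝ → ℝ≥0∞ := fun z => ENNReal.ofReal (Real.exp (-2 * z ^ 2)) with hh
  set k : ℝ → ℝ≥0∞ := fun s => ENNReal.ofReal ((1 + |s|)⁻¹) with hk
  have hhm : Measurable h := by fun_prop
  have hkm : Measurable k := by fun_prop
  set K : ℝ≥0∞ := 2 ^ (r - 1) *
    ((∫⁻ z, h z) ^ r * (∫⁻ s, k s ^ r) + ∫⁻ z, h z ^ r) with hK_def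
  have hh1 : ∫⁻ z, h z ≠ ∞ := by
    simpa only [ENNReal.rpow_one] using lintegral_gaussian_rpow_ne_top two_pos one_pos
  have hK : K ≠ ∞ := by
    refine ENNReal.mul_ne_top (ENNReal.rpow_ne_top_of_nonneg (by linarith) (by simp))
      (ENNReal.add_ne_top.2 ⟨ENNReal.mul_ne_top (ENNReal.rpow_ne_top_of_nonneg hr0.le hh1)
        (lintegral_one_add_abs_inv_rpow_ne_top hr), lintegral_gaussian_rpow_ne_top two_pos hr0⟩)
  set B : ℝ≥0∞ := c⁻¹ * C * K ^ (1 / r) with hB_def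
  have hB : B ≠ ∞ := ENNReal.mul_ne_top (ENNReal.mul_ne_top (ENNReal.inv_ne_top.2 hc) hC)
    (ENNReal.rpow_ne_top_of_nonneg (by positivity) hK)
  refine ⟨B.toNNReal + 1, by positivity, fun f g => ?_⟩
  have hBle : B ≤ ((B.toNNReal + 1 : ℝ≥0) : ℝ≥0∞) := by
    rw [ENNReal.coe_add, ENNReal.coe_toNNReal hB]
    exact le_self_add
  rw [mul_assoc]
  refine le_trans ?_ (mul_le_mul_left hBle _)
  rw [modNorm1, eNorm, if_pos rfl]
  refine essSup_le_of_ae_le _ (Filter.Eventually.of_forall fun ν => ?_)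
  beta_reduce
  rw [eNorm, if_neg ENNReal.ofReal_ne_top, ENNReal.toReal_ofReal hr0.le]
  set F : ℝ → ℝ → ℝ≥0∞ := fun t ξ => ‖STFT1 gauss1 f t ξ‖ₑ with hF
  set G : ℝ → ℝ → ℝ≥0∞ := fun t ξ => ‖STFT1 gauss1 g t ξ‖ₑ with hG
  have hpt (x : ℝ) : ‖STFT1 gauss1 (BH f g) x ν‖ₑ ≤ c⁻¹ * C *
      ∫⁻ z, h z * ((∫⁻ s, crossMass F G ν (x + z) s * k s) + crossMass F G ν (x + z) 0) := by
    rw [mul_assoc, ← ENNReal.mul_le_iff_le_inv hc hc']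
    refine (ofReal_mul_enorm_STFT1_BH_le f g x ν).trans ?_
    rw [← lintegral_const_mul' _ _ hC]
    refine lintegral_mono fun z => ?_
    rw [mul_left_comm]
    exact mul_le_mul_right (hW f g ν (x + z)) _
  have hmain := lintegral_rpow_smoothed_crossMass_le (F := F) (G := G)
    (continuous_STFT1 f.integrable).enorm (continuous_STFT1 g.integrable).enorm
    hp hq hp' hq' hpc hqc ν hr hhm hkm
  have hCr : (c⁻¹ * C) ^ r ≠ ∞ := ENNReal.rpow_ne_top_of_nonneg hr0.le
    (ENNReal.mul_ne_top (ENNReal.inv_ne_top.2 hc) hC)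
  calc (∫⁻ x, (‖STFT1 gauss1 (BH f g) x ν‖₊ : ℝ≥0∞) ^ r) ^ (1 / r)
      ≤ ((c⁻¹ * C) ^ r * (K * (modNorm1 p q f * modNorm1 p' q' g) ^ r)) ^ (1 / r) := by
        gcongr
        refine le_trans (lintegral_mono fun x => ENNReal.rpow_le_rpow (hpt x) hr0.le) ?_
        simp only [ENNReal.mul_rpow_of_nonneg (c⁻¹ * C) _ hr0.le]
        rw [lintegral_const_mul' _ _ hCr]
        gcongr
        exact hmain
    _ = B * (modNorm1 p q f * modNorm1 p' q' g) := by
        have hr1 : 0 ≤ 1 / r := by positivity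
        rw [ENNReal.mul_rpow_of_nonneg _ _ hr1, ENNReal.mul_rpow_of_nonneg _ _ hr1,
          ← ENNReal.rpow_mul, ← ENNReal.rpow_mul, mul_one_div_cancel hr0.ne', ENNReal.rpow_one,
          ENNReal.rpow_one, hB_def, ← mul_assoc]

end
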